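/- Suppose {u_n} ⊂ H^2(R^N) with ||u_n||_2 = a, satisfying P_μ(u_n) = 2||Δu_n||_2² − μ||∇u_n||_2² − 2γ_p||u_n||_p^p → 0 and E_μ(u_n) → c with c bounded, μ > 0, pγ_p > 2. Then {||Δu_n||_2} is bounded, and hence {u_n} is bounded in H^2(R^N). -/

import Mathlib

open MeasureTheory Filter Topology

noncomputable def lapl {N : ℕ} (u : EuclideanSpace ℝ (Fin N) → ℝ)
    (x : EuclideanSpace ℝ (Fin N)) : ℝ :=
  ∑ i : Fin N, iteratedFDeriv ℝ 2 u x ![EuclideanSpace.single i 1, EuclideanSpace.single i 1]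

lemma integrable_mul_of_integrable_sq {α : Type*} [MeasurableSpace α] {m : Measure α}
    {f g : α → ℝ} (hf : AEStronglyMeasurable f m) (hg : AEStronglyMeasurable g m)
    (hf2 : Integrable (fun x => f x ^ 2) m) (hg2 : Integrable (fun x => g x ^ 2) m) :
    Integrable (fun x => f x * g x) m :=
  ((memLp_two_iff_integrable_sq hf).2 hf2).integrable_mul ((memLp_two_iff_integrable_sq hg).2 hg2)

lemma fderiv_apply_gradient_eq_sum {N : ℕ} (u φ : EuclideanSpace ℝ (Fin N) → ℝ)
    (x : EuclideanSpace ℝ (Fin N)) :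
    fderiv ℝ φ x (gradient u x) = ∑ i : Fin N,
      fderiv ℝ φ x (EuclideanSpace.single i 1) * fderiv ℝ u x (EuclideanSpace.single i 1) := by
  have h := (EuclideanSpace.basisFun (Fin N) ℝ).sum_inner_mul_inner (gradient φ x) (gradient u x)
  simp only [inner_gradient_left, EuclideanSpace.basisFun_apply] at h
  rw [← h]
  refine Finset.sum_congr rfl fun i _ => ?_
  rw [real_inner_comm, inner_gradient_left]

lemma norm_gradient_sq_eq_fderiv {N : ℕ} (u : EuclideanSpace ℝ (Fin N) → ℝ)
    (x : EuclideanSpace ℝ (Fin N)) : ‖gradient u x‖ ^ 2 = fderiv ℝ u x (gradient u x) := by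
  rw [← inner_gradient_left, real_inner_self_eq_norm_sq]

lemma continuous_lapl {N : ℕ} {u : EuclideanSpace ℝ (Fin N) → ℝ} (hu : ContDiff ℝ 2 u) :
    Continuous (lapl u) := by
  unfold lapl
  have h := hu.continuous_iteratedFDeriv (m := 2) le_rfl
  fun_prop

lemma continuous_gradient {N : ℕ} {u : EuclideanSpace ℝ (Fin N) → ℝ} (hu : ContDiff ℝ 1 u) :
    Continuous (gradient u) := by
  unfold gradient
  exact (LinearIsometryEquiv.continuous _).comp (hu.continuous_fderiv one_ne_zero)

/-- Green's identity tested against a compactly supported cutoff function. -/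
lemma integral_cutoff_green {N : ℕ} {u φ : EuclideanSpace ℝ (Fin N) → ℝ} (hu : ContDiff ℝ 2 u)
    (hφ : ContDiff ℝ 1 φ) (hc : HasCompactSupport φ) :
    ∫ x, (φ x * (‖gradient u x‖ ^ 2 + u x * lapl u x) + u x * fderiv ℝ φ x (gradient u x)) = 0 := by
  have hu1 : ContDiff ℝ 1 u := hu.of_le one_le_two
  have hdu : ContDiff ℝ 1 (fderiv ℝ u) := hu.fderiv_right (by norm_num)
  have hcu := hu.continuous
  have hcφ := hφ.continuous
  have hcdu := hdu.continuous
  have hcddu := hdu.continuous_fderiv one_ne_zero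
  have hcdφ := hφ.continuous_fderiv one_ne_zero
  set e : Fin N → EuclideanSpace ℝ (Fin N) := fun i => EuclideanSpace.single i 1 with he
  have hprod : ContDiff ℝ 1 (fun x => φ x * u x) := hφ.mul hu1
  have hcprod : HasCompactSupport (fun x => φ x * u x) := hc.mul_right
  have hi : ∀ i, Integrable (fun x => φ x * u x * fderiv ℝ (fderiv ℝ u) x (e i) (e i)) := fun i =>
    Continuous.integrable_of_hasCompactSupport (by fun_prop) hcprod.mul_right
  have hi' : ∀ i, Integrable
      (fun x => fderiv ℝ (fun y => φ y * u y) x (e i) * fderiv ℝ u x (e i)) := fun i =>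
    Continuous.integrable_of_hasCompactSupport
      (((hprod.continuous_fderiv one_ne_zero).clm_apply continuous_const).mul (by fun_prop))
      (hcprod.fderiv_apply (𝕜 := ℝ) (e i)).mul_right
  have hder : ∀ i x, fderiv ℝ (fun y => fderiv ℝ u y (e i)) x (e i)
      = fderiv ℝ (fderiv ℝ u) x (e i) (e i) := fun i x => by
    rw [fderiv_clm_apply (hdu.differentiable one_ne_zero x) (by fun_prop)]
    simp
  have key : ∀ i, ∫ x, (φ x * u x * fderiv ℝ (fderiv ℝ u) x (e i) (e i)
      + fderiv ℝ (fun y => φ y * u y) x (e i) * fderiv ℝ u x (e i)) = 0 := fun i => by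
    have h := integral_mul_fderiv_eq_neg_fderiv_mul_of_integrable
      (μ := (volume : Measure (EuclideanSpace ℝ (Fin N)))) (v := e i)
      (f := fun x => φ x * u x) (g := fun x => fderiv ℝ u x (e i))
      (hi' i) (by simpa only [hder] using hi i)
      (Continuous.integrable_of_hasCompactSupport (by fun_prop) hcprod.mul_right)
      (fun x _ => hprod.differentiable one_ne_zero x)
      (fun x _ => (hdu.clm_apply contDiff_const).differentiable one_ne_zero x)
    simp only [hder] at h
    rw [integral_add (hi i) (hi' i), h, neg_add_cancel]
  have hsum := integral_finsetSum Finset.univ fun i _ => (hi i).add (hi' i)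
  simp only [Pi.add_apply, key, Finset.sum_const_zero] at hsum
  rw [← hsum]
  congr 1 with x
  have hd : ∀ v, fderiv ℝ (fun y => φ y * u y) x v = φ x * fderiv ℝ u x v + u x * fderiv ℝ φ x v :=
    fun v => by
      rw [fderiv_fun_mul (hφ.differentiable one_ne_zero x) (hu1.differentiable one_ne_zero x)]
      simp
  have hl : lapl u x = ∑ i, fderiv ℝ (fderiv ℝ u) x (e i) (e i) := by
    simp [lapl, iteratedFDeriv_two_apply, he]
  rw [norm_gradient_sq_eq_fderiv, fderiv_apply_gradient_eq_sum, fderiv_apply_gradient_eq_sum, hl]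
  simp only [hd, mul_add, Finset.mul_sum, ← Finset.sum_add_distrib]
  refine Finset.sum_congr rfl fun i _ => ?_
  ring

/-- There are smooth cutoffs exhausting the space, with gradients uniformly bounded and tending
pointwise to zero. -/
lemma exists_cutoff_sequence (E : Type*) [NormedAddCommGroup E] [InnerProductSpace ℝ E]
    [FiniteDimensional ℝ E] :
    ∃ (φ : ℕ → E → ℝ) (C : ℝ), (∀ n, ContDiff ℝ 1 (φ n)) ∧ (∀ n, HasCompactSupport (φ n)) ∧
      (∀ n x, |φ n x| ≤ 1) ∧ (∀ n x, ‖fderiv ℝ (φ n) x‖ ≤ C) ∧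
      (∀ x, Tendsto (fun n => φ n x) atTop (𝓝 1)) ∧
      ∀ x, Tendsto (fun n => fderiv ℝ (φ n) x) atTop (𝓝 0) := by
  let f : ContDiffBump (0 : E) := ⟨1, 2, one_pos, one_lt_two⟩
  have hf : ContDiff ℝ 1 f := f.contDiff
  have hcf : HasCompactSupport f := f.hasCompactSupport
  obtain ⟨C, hC⟩ := (hcf.fderiv (𝕜 := ℝ)).exists_bound_of_continuous
    (hf.continuous_fderiv one_ne_zero)
  have hC0 : 0 ≤ C := (norm_nonneg _).trans (hC 0)
  have hr : Tendsto (fun n : ℕ => (1 / ((n : ℝ) + 1))) atTop (𝓝 0) :=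
    tendsto_one_div_add_atTop_nhds_zero_nat
  have hpos : ∀ n : ℕ, 0 < 1 / ((n : ℝ) + 1) := fun n => Nat.one_div_pos_of_nat
  have hbd : ∀ (n : ℕ) x, ‖fderiv ℝ (fun y => f ((1 / ((n : ℝ) + 1)) • y)) x‖
      ≤ 1 / ((n : ℝ) + 1) * C := fun n x => by
    rw [fderiv_comp_smul, norm_smul, Real.norm_of_nonneg (hpos n).le]
    exact mul_le_mul_of_nonneg_left (hC _) (hpos n).le
  refine ⟨fun n x => f ((1 / ((n : ℝ) + 1)) • x), C, fun n => hf.comp (contDiff_const_smul _),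
    fun n => hcf.comp_smul (hpos n).ne', fun n x => ?_, fun n x => (hbd n x).trans ?_,
    fun x => ?_, fun x => ?_⟩
  · rw [abs_of_nonneg f.nonneg]
    exact f.le_one
  · refine mul_le_of_le_one_left hC0 ?_
    rw [div_le_one (by positivity)]
    simp
  · have hx : Tendsto (fun n : ℕ => (1 / ((n : ℝ) + 1)) • x) atTop (𝓝 0) := by
      simpa only [zero_smul] using hr.smul_const x
    have h := (hf.continuous.tendsto 0).comp hx
    rwa [f.one_of_mem_closedBall (Metric.mem_closedBall_self zero_le_one)] at h
  · refine squeeze_zero_norm (fun n => hbd n x) ?_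
    simpa using hr.mul_const C

/-- Green's identity on the whole space. -/
lemma integral_norm_gradient_sq_add_mul_lapl {N : ℕ} {u : EuclideanSpace ℝ (Fin N) → ℝ}
    (hu : ContDiff ℝ 2 u) (h0 : Integrable (fun x => u x ^ 2))
    (h1 : Integrable (fun x => ‖gradient u x‖ ^ 2)) (h2 : Integrable (fun x => lapl u x ^ 2)) :
    ∫ x, (‖gradient u x‖ ^ 2 + u x * lapl u x) = 0 := by
  obtain ⟨φ, C, hφ, hc, hle, hC, hφ1, hφ0⟩ := exists_cutoff_sequence (EuclideanSpace ℝ (Fin N))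
  have hcu := hu.continuous
  have hcl := continuous_lapl hu
  have hcg := continuous_gradient (hu.of_le one_le_two)
  have hul := integrable_mul_of_integrable_sq hcu.aestronglyMeasurable
    hcl.aestronglyMeasurable h0 h2
  have hug := integrable_mul_of_integrable_sq hcu.aestronglyMeasurable
    hcg.norm.aestronglyMeasurable h0 h1
  have hlim := tendsto_integral_of_dominated_convergence
    (μ := (volume : Measure (EuclideanSpace ℝ (Fin N))))
    (F := fun n x => φ n x * (‖gradient u x‖ ^ 2 + u x * lapl u x)
      + u x * fderiv ℝ (φ n) x (gradient u x))
    (f := fun x => ‖gradient u x‖ ^ 2 + u x * lapl u x)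
    (fun x => ‖‖gradient u x‖ ^ 2 + u x * lapl u x‖ + C * ‖u x * ‖gradient u x‖‖)
    (fun n => by
      have := (hφ n).continuous
      have := (hφ n).continuous_fderiv one_ne_zero
      exact Continuous.aestronglyMeasurable (by fun_prop))
    ((h1.add hul).norm.add (hug.norm.const_mul C))
    (fun n => ae_of_all _ fun x => by
      refine (norm_add_le _ _).trans (add_le_add ?_ ?_)
      · rw [norm_mul]
        exact mul_le_of_le_one_left (norm_nonneg _) (hle n x)
      · rw [norm_mul, norm_mul, norm_norm, mul_left_comm]
        exact mul_le_mul_of_nonneg_left ((fderiv ℝ (φ n) x).le_of_opNorm_le (hC n x) _)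
          (norm_nonneg _))
    (ae_of_all _ fun x => by
      have hz : Tendsto (fun n => fderiv ℝ (φ n) x (gradient u x)) atTop (𝓝 0) := by
        simpa [Function.comp_def] using
          ((ContinuousLinearMap.apply ℝ ℝ (gradient u x)).continuous.tendsto 0).comp (hφ0 x)
      simpa using ((hφ1 x).mul_const (‖gradient u x‖ ^ 2 + u x * lapl u x)).add
        (hz.const_mul (u x)))
  simp only [fun n => integral_cutoff_green hu (hφ n) (hc n)] at hlim
  exact tendsto_nhds_unique hlim tendsto_const_nhds

/-- The interpolation inequality between `u`, `∇u` and `Δu`, in weighted form. -/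
lemma integral_norm_gradient_sq_le {N : ℕ} {u : EuclideanSpace ℝ (Fin N) → ℝ}
    (hu : ContDiff ℝ 2 u) (h0 : Integrable (fun x => u x ^ 2))
    (h1 : Integrable (fun x => ‖gradient u x‖ ^ 2)) (h2 : Integrable (fun x => lapl u x ^ 2))
    {t : ℝ} (ht : 0 < t) :
    ∫ x, ‖gradient u x‖ ^ 2 ≤ t / 2 * (∫ x, u x ^ 2) + 1 / (2 * t) * ∫ x, lapl u x ^ 2 := by
  have hul := integrable_mul_of_integrable_sq hu.continuous.aestronglyMeasurable
    (continuous_lapl hu).aestronglyMeasurable h0 h2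
  have h := integral_norm_gradient_sq_add_mul_lapl hu h0 h1 h2
  rw [integral_add h1 hul] at h
  have hmono : ∫ x, -(u x * lapl u x) ≤ ∫ x, (t / 2 * u x ^ 2 + 1 / (2 * t) * lapl u x ^ 2) := by
    refine integral_mono hul.neg ((h0.const_mul _).add (h2.const_mul _)) fun x => ?_
    have hsq : t / 2 * u x ^ 2 + 1 / (2 * t) * lapl u x ^ 2 + u x * lapl u x
        = (t * u x + lapl u x) ^ 2 / (2 * t) := by
      field_simp
      ring
    have : 0 ≤ (t * u x + lapl u x) ^ 2 / (2 * t) := by positivity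
    dsimp only
    linarith
  rw [integral_neg, integral_add (h0.const_mul _) (h2.const_mul _), integral_const_mul,
    integral_const_mul] at hmono
  linarith

theorem stmt_11 {N : ℕ} (u : ℕ → EuclideanSpace ℝ (Fin N) → ℝ) (a μ p γ c : ℝ)
    (ha : 0 < a) (hμ : 0 < μ) (hp : 2 < p)
    (hγ : γ = (N : ℝ) * (p - 2) / (4 * p)) (hpγ : 2 < p * γ)
    (hu : ∀ n, ContDiff ℝ 2 (u n))
    (hi : ∀ n, Integrable (fun x => (u n x) ^ 2) ∧
      Integrable (fun x => ‖gradient (u n) x‖ ^ 2) ∧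
      Integrable (fun x => (lapl (u n) x) ^ 2) ∧ Integrable (fun x => |u n x| ^ p))
    (hmass : ∀ n, (∫ x, (u n x) ^ 2) = a ^ 2)
    (hP : Tendsto (fun n => 2 * (∫ x, (lapl (u n) x) ^ 2)
        - μ * (∫ x, ‖gradient (u n) x‖ ^ 2) - 2 * γ * (∫ x, |u n x| ^ p)) atTop (𝓝 0))
    (hE : Tendsto (fun n => 1 / 2 * (∫ x, (lapl (u n) x) ^ 2)
        - μ / 2 * (∫ x, ‖gradient (u n) x‖ ^ 2) - 1 / p * (∫ x, |u n x| ^ p)) atTop (𝓝 c)) :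
    (∃ M : ℝ, ∀ n, (∫ x, (lapl (u n) x) ^ 2) ≤ M) ∧
    (∃ M : ℝ, ∀ n, (∫ x, (u n x) ^ 2) + (∫ x, ‖gradient (u n) x‖ ^ 2)
        + (∫ x, (lapl (u n) x) ^ 2) ≤ M) := by
  set D : ℕ → ℝ := fun n => ∫ x, (lapl (u n) x) ^ 2 with hD
  set G : ℕ → ℝ := fun n => ∫ x, ‖gradient (u n) x‖ ^ 2 with hG
  have hint : ∀ n, ∀ t : ℝ, 0 < t → G n ≤ t / 2 * a ^ 2 + 1 / (2 * t) * D n := fun n t ht => by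
    obtain ⟨h0, h1, h2, -⟩ := hi n
    simpa only [hmass n] using integral_norm_gradient_sq_le (hu n) h0 h1 h2 ht
  have hp0 : p ≠ 0 := by positivity
  have hγ0 : γ ≠ 0 := by
    rintro rfl
    norm_num at hpγ
  obtain ⟨M, hM⟩ := (hE.sub (hP.const_mul (1 / (2 * (p * γ))))).bddAbove_range
  have hk : 1 / (p * γ) < 1 / 2 := one_div_lt_one_div_of_lt two_pos hpγ
  have hk0 : 0 < 1 / (p * γ) := by positivity
  have hcomb : ∀ n, (1 / 2 - 1 / (p * γ)) * D n - μ / 2 * (1 - 1 / (p * γ)) * G n ≤ M :=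
    fun n => by
      refine le_trans (le_of_eq ?_) (hM ⟨n, rfl⟩)
      simp only [hD, hG]
      field_simp
      ring
  have hG0 : ∀ n, 0 ≤ G n := fun n => integral_nonneg fun x => sq_nonneg _
  set α : ℝ := 1 / 2 - 1 / (p * γ) with hα
  have hα0 : 0 < α := by linarith
  have hbound : ∀ n, D n ≤ 2 / α * (M + μ / 2 * (μ / (2 * α) / 2 * a ^ 2)) := fun n => by
    have h1 := hint n (μ / (2 * α)) (by positivity)
    have h2 : μ / 2 * (1 - 1 / (p * γ)) * G n ≤ μ / 2 * G n := by
      refine mul_le_mul_of_nonneg_right ?_ (hG0 n)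
      exact mul_le_of_le_one_right (by positivity) (by linarith)
    have h3 := mul_le_mul_of_nonneg_left h1 (half_pos hμ).le
    have h4 : μ / 2 * (1 / (2 * (μ / (2 * α))) * D n) = α / 2 * D n := by
      field_simp
    rw [mul_add, h4] at h3
    have h5 : α / 2 * D n ≤ M + μ / 2 * (μ / (2 * α) / 2 * a ^ 2) := by
      linarith [hcomb n]
    calc D n = 2 / α * (α / 2 * D n) := by field_simp
      _ ≤ _ := mul_le_mul_of_nonneg_left h5 (by positivity)
  refine ⟨⟨_, hbound⟩, 2 * a ^ 2 + 2 * (2 / α * (M + μ / 2 * (μ / (2 * α) / 2 * a ^ 2))),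
    fun n => ?_⟩
  have h1 := hint n 1 one_pos
  rw [hmass n]
  change a ^ 2 + G n + D n ≤ _
  have hD0 : 0 ≤ D n := integral_nonneg fun x => sq_nonneg _
  linarith [hbound n, sq_nonneg a]
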